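/- arXiv:1511.07068 — 5 statements merged into one kernel-verified Lean document; each statement's English description precedes it below -/
import Mathlib

section
/- Let X and Y be real Banach spaces, C ⊆ X and D ⊆ Y nonempty, closed and convex subsets, f : C → X* and g : D → Y* continuous operators, and A : X → Y a bounded linear operator such that (a1) A(C) = D and (a2) A is convexity direction reserved with respect to f and g on C and D. If there is a point x₀ ∈ C such that the set {(x', Ax') ∈ C × D : ⟨f(x'), x₀ − x'⟩ ≥ 0 and ⟨g(Ax'), Ax₀ − Ax'⟩ ≥ 0} is compact in X × Y, then there exists x* ∈ C such that ⟨f(x*), x − x*⟩ ≥ 0 for all x ∈ C and, with y* = Ax* ∈ D, ⟨g(y*), y − y*⟩ ≥ 0 for all y ∈ D. -/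
open Metric Set MeasureTheory

open Polynomial in
lemma ContinuousLinearMap.exists_polynomial_eval_eq_det_one_add_smul {E : Type*}
    [NormedAddCommGroup E] [NormedSpace ℝ E] [FiniteDimensional ℝ E] (M : E →L[ℝ] E) :
    ∃ p : ℝ[X], p.degree < (Module.finrank ℝ E + 1 : ℕ) ∧
      ∀ t : ℝ, p.eval t = (1 + t • M).det := by
  classical
  let b := Module.finBasis ℝ E
  let B := LinearMap.toMatrix b b (M : E →ₗ[ℝ] E)
  refine ⟨((X : ℝ[X]) • B.map C + (1 : Matrix _ _ ℝ).map C).det, ?_, fun t ↦ ?_⟩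
  · refine lt_of_le_of_lt degree_le_natDegree ?_
    have := natDegree_det_X_add_C_le B 1
    rw [Fintype.card_fin] at this
    exact_mod_cast Nat.lt_succ_of_le this
  · rw [← coe_evalRingHom, RingHom.map_det, ContinuousLinearMap.det, ← LinearMap.det_toMatrix b]
    congr 1
    ext i j
    simp only [B, LinearMap.toMatrix_apply]
    by_cases hij : i = j
    · simp [hij, LinearMap.toMatrix_apply]; ring
    · simp [hij, LinearMap.toMatrix_apply]; grind

lemma LipschitzOnWith.indicator_closedBall {E F : Type*} [NormedAddCommGroup E] [NormedSpace ℝ E]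
    [NormedAddCommGroup F] {h : E → F} {L : NNReal} {R : ℝ}
    (hL : LipschitzOnWith L h (closedBall 0 R)) (h0 : ∀ x, ‖x‖ = R → h x = 0) :
    LipschitzWith L ((closedBall 0 R).indicator h) := by
  have aux : ∀ x y : E, x ∈ closedBall (0 : E) R → y ∉ closedBall (0 : E) R →
      ‖h x‖ ≤ L * ‖x - y‖ := by
    intro x y hx hy
    obtain ⟨z, hz, hzR⟩ := (convex_segment x y).isPreconnected.intermediate_value
      (left_mem_segment ℝ x y) (right_mem_segment ℝ x y) continuous_norm.continuousOn
      (show R ∈ Icc ‖x‖ ‖y‖ by simp at hx hy; exact ⟨hx, hy.le⟩)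
    have h1 := hL.norm_sub_le hx (show z ∈ closedBall (0 : E) R by simp [hzR])
    rw [h0 z hzR, sub_zero] at h1
    refine h1.trans (mul_le_mul_of_nonneg_left ?_ L.2)
    have := dist_add_dist_of_mem_segment hz
    rw [← dist_eq_norm, ← dist_eq_norm]
    linarith [dist_nonneg (x := z) (y := y)]
  refine LipschitzWith.of_dist_le_mul fun x y ↦ ?_
  rw [dist_eq_norm, dist_eq_norm]
  by_cases hx : x ∈ closedBall (0 : E) R <;> by_cases hy : y ∈ closedBall (0 : E) R
  · simpa only [indicator_of_mem, hx, hy] using hL.norm_sub_le hx hy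
  · simpa only [indicator_of_mem, indicator_of_notMem, hx, hy, not_false_eq_true, sub_zero]
      using aux x y hx hy
  · simpa only [indicator_of_mem, indicator_of_notMem, hx, hy, not_false_eq_true, zero_sub,
      norm_neg, norm_sub_rev x y] using aux y x hy hx
  · simp only [indicator_of_notMem, hx, hy, not_false_eq_true, sub_zero, norm_zero]
    positivity

lemma LipschitzWith.bijective_id_add {E : Type*} [NormedAddCommGroup E] [NormedSpace ℝ E]
    [CompleteSpace E] {k : E → E} {c : NNReal} (hk : LipschitzWith c k) (hc : c < 1) :
    Function.Bijective (fun x ↦ x + k x) := by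
  have hA : ApproximatesLinearOn (fun x ↦ x + k x)
      ((ContinuousLinearEquiv.refl ℝ E : E ≃L[ℝ] E) : E →L[ℝ] E) univ c := by
    rw [ApproximatesLinearOn.approximatesLinearOn_iff_lipschitzOnWith, lipschitzOnWith_univ]
    convert hk using 1
    ext x
    simp
  have hc' : Subsingleton E ∨ c < ‖((ContinuousLinearEquiv.refl ℝ E).symm : E →L[ℝ] E)‖₊⁻¹ := by
    rcases subsingleton_or_nontrivial E with h | h
    · exact .inl h
    · right
      have : ‖((ContinuousLinearEquiv.refl ℝ E).symm : E →L[ℝ] E)‖₊ = 1 := by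
        ext
        simp
      rw [this]; simpa using hc
  exact ⟨injOn_univ.mp (hA.injOn hc'), hA.surjective hc'⟩

lemma integral_det_id_add_of_lipschitz {E : Type*} [NormedAddCommGroup E] [NormedSpace ℝ E]
    [FiniteDimensional ℝ E] [MeasurableSpace E] [BorelSpace E] (μ : Measure E) [μ.IsAddHaarMeasure]
    {k : E → E} {k' : E → E →L[ℝ] E} {c : NNReal} {R : ℝ} (hk : ∀ x, HasFDerivAt k (k' x) x)
    (hL : LipschitzOnWith c k (closedBall 0 R)) (hc : c < 1) (h0 : ∀ x, ‖x‖ = R → k x = 0)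
    (hdet : ∀ x ∈ ball (0 : E) R, 0 ≤ (1 + k' x).det) :
    ∫ x in ball (0 : E) R, (1 + k' x).det ∂μ = μ.real (ball (0 : E) R) := by
  have : CompleteSpace E := FiniteDimensional.complete ℝ E
  obtain ⟨hinj, hsurj⟩ := (hL.indicator_closedBall h0).bijective_id_add hc
  set K := (closedBall (0 : E) R).indicator k with hK
  have hout : ∀ x, R ≤ ‖x‖ → K x = 0 := by
    intro x hx
    by_cases hx' : x ∈ closedBall (0 : E) R
    · rw [hK, indicator_of_mem hx', h0 x (le_antisymm (by simpa using hx') hx)]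
    · rw [hK, indicator_of_notMem hx']
  have hin : EqOn (fun x ↦ x + K x) (fun x ↦ x + k x) (ball (0 : E) R) := fun x hx ↦ by
    simp only [hK, indicator_of_mem (ball_subset_closedBall hx)]
  have himg : (fun x ↦ x + k x) '' ball (0 : E) R = ball 0 R := by
    rw [← hin.image_eq]
    apply Subset.antisymm
    · rintro _ ⟨x, hx, rfl⟩
      by_contra hy
      have hy' : R ≤ ‖x + K x‖ := by simpa using hy
      have : x + K x = x := hinj (by simp only [hout _ hy', add_zero])
      simp only [this] at hy
      exact hy hx
    · intro y hy
      obtain ⟨x, rfl⟩ := hsurj y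
      refine ⟨x, ?_, rfl⟩
      by_contra hx
      have hx' : R ≤ ‖x‖ := by simpa using hx
      simp only [hout x hx', add_zero] at hy
      exact hx hy
  have key := integral_image_eq_integral_abs_det_fderiv_smul μ (measurableSet_ball (x := (0 : E)))
    (f := fun x ↦ x + k x) (f' := fun x ↦ 1 + k' x)
    (fun x _ ↦ ((hasFDerivAt_id x).add (hk x)).hasFDerivWithinAt) (hinj.injOn.congr hin)
    (fun _ ↦ (1 : ℝ))
  rw [himg] at key
  simp only [integral_const, smul_eq_mul, mul_one, measureReal_restrict_apply_univ] at key
  rw [key]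
  exact setIntegral_congr_fun measurableSet_ball fun x hx ↦ (abs_of_nonneg (hdet x hx)).symm

lemma ContDiff.exists_lipschitzOnWith_of_isCompact {E F : Type*} [NormedAddCommGroup E]
    [NormedSpace ℝ E] [NormedAddCommGroup F] [NormedSpace ℝ F] {h : E → F} (hh : ContDiff ℝ 1 h)
    {s : Set E} (hs : IsCompact s) (hsc : Convex ℝ s) :
    ∃ L : NNReal, 0 < L ∧ (∀ x ∈ s, ‖fderiv ℝ h x‖ ≤ L) ∧ LipschitzOnWith L h s := by
  obtain ⟨L, hL⟩ := hs.exists_bound_of_continuousOn (hh.continuous_fderiv one_ne_zero).continuousOn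
  have hL' : ∀ x ∈ s, ‖fderiv ℝ h x‖ ≤ (max L.toNNReal 1 : NNReal) := fun x hx ↦
    (hL x hx).trans ((Real.le_coe_toNNReal L).trans (by exact_mod_cast le_max_left _ _))
  refine ⟨max L.toNNReal 1, lt_max_of_lt_right one_pos, hL', ?_⟩
  exact hsc.lipschitzOnWith_of_nnnorm_fderiv_le
    (fun x _ ↦ hh.differentiable one_ne_zero x) hL'

lemma det_fderiv_eq_zero_of_norm_eq {E : Type*} [NormedAddCommGroup E] [InnerProductSpace ℝ E]
    [FiniteDimensional ℝ E] {r : E → E} {R : ℝ} (hR : 0 < R) (hr : ∀ x, ‖r x‖ = R) {x : E}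
    (hd : DifferentiableAt ℝ r x) : (fderiv ℝ r x).det = 0 := by
  by_contra hdet
  have hsurj : Function.Surjective (fderiv ℝ r x) := by
    exact ((fderiv ℝ r x).toContinuousLinearEquivOfDetNeZero hdet).surjective
  obtain ⟨v, hv⟩ := hsurj (r x)
  have h1 : HasFDerivAt (fun y ↦ inner ℝ (r y) (r y)) _ x :=
    hd.hasFDerivAt.inner ℝ hd.hasFDerivAt
  have h2 : (fun y ↦ inner ℝ (r y) (r y)) = fun _ ↦ R ^ 2 := by
    ext y; rw [real_inner_self_eq_norm_sq, hr]
  rw [h2] at h1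
  have h3 := congrArg (fun T : E →L[ℝ] ℝ ↦ T v) (h1.unique (hasFDerivAt_const _ _))
  simp [hv, hr] at h3
  linarith

lemma not_exists_contDiff_retraction_sphere {E : Type*} [NormedAddCommGroup E]
    [InnerProductSpace ℝ E] [FiniteDimensional ℝ E] {r : E → E} {R : ℝ} (hR : 0 < R)
    (hd : ContDiff ℝ 1 r) (hr : ∀ x, ‖r x‖ = R) : ¬ ∀ x, ‖x‖ = R → r x = x := by
  intro hfix
  let _ : MeasurableSpace E := borel E
  have _ : BorelSpace E := ⟨rfl⟩
  let μ : Measure E := Measure.addHaar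
  let h : E → E := fun x ↦ r x - x
  have hh : ContDiff ℝ 1 h := hd.sub contDiff_id
  have hdiff : ∀ x, HasFDerivAt h (fderiv ℝ h x) x := fun x ↦
    (hh.differentiable one_ne_zero x).hasFDerivAt
  obtain ⟨L, hL0, hLb, hL⟩ := hh.exists_lipschitzOnWith_of_isCompact
    (isCompact_closedBall (0 : E) R) (convex_closedBall 0 R)
  obtain ⟨δ, hδ, hdet⟩ : ∃ δ > 0, ∀ M : E →L[ℝ] E, ‖M‖ < δ → 0 ≤ (1 + M).det := by
    have hc : ContinuousAt (fun M : E →L[ℝ] E ↦ (1 + M).det) 0 :=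
      (ContinuousLinearMap.continuous_det.comp (continuous_const.add continuous_id)).continuousAt
    have hpos : (0 : ℝ) < (1 + (0 : E →L[ℝ] E)).det := by
      rw [add_zero, ContinuousLinearMap.det]
      simp
    obtain ⟨δ, hδ, H⟩ := Metric.eventually_nhds_iff.mp (hc.eventually (lt_mem_nhds hpos))
    exact ⟨δ, hδ, fun M hM ↦ (H (by simpa using hM)).le⟩
  obtain ⟨ε, hε, hεδ, hε1⟩ : ∃ ε : ℝ, 0 < ε ∧ ε * L < δ ∧ ε * L < 1 := by
    have hL0' : (0 : ℝ) < L := hL0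
    refine ⟨min δ 1 / (2 * L), by positivity, ?_, ?_⟩ <;>
      rw [div_mul_eq_mul_div, div_lt_iff₀ (by positivity)]
    · nlinarith [min_le_left δ 1]
    · nlinarith [min_le_right δ 1]
  have hsmall : ∀ t : ℝ, 0 ≤ t → t ≤ ε →
      ∫ x in ball (0 : E) R, (1 + t • fderiv ℝ h x).det ∂μ = μ.real (ball (0 : E) R) := by
    intro t ht htε
    have htL : t * L ≤ ε * L := mul_le_mul_of_nonneg_right htε L.2
    refine integral_det_id_add_of_lipschitz μ (k := fun x ↦ t • h x) (c := t.toNNReal * L)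
      (fun x ↦ (hdiff x).const_smul t) ?_ ?_ ?_ ?_
    · refine LipschitzOnWith.of_dist_le_mul fun x hx y hy ↦ ?_
      rw [dist_smul₀, NNReal.coe_mul, Real.coe_toNNReal t ht, Real.norm_of_nonneg ht, mul_assoc]
      exact mul_le_mul_of_nonneg_left (hL.dist_le_mul x hx y hy) ht
    · rw [← NNReal.coe_lt_coe, NNReal.coe_mul, Real.coe_toNNReal t ht]
      exact htL.trans_lt hε1
    · intro x hx
      simp [h, hfix x hx]
    · intro x hx
      refine hdet _ (lt_of_le_of_lt ?_ hεδ)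
      rw [norm_smul, Real.norm_of_nonneg ht]
      exact (mul_le_mul_of_nonneg_left (hLb x (ball_subset_closedBall hx)) ht).trans htL
  have hdet_int : ∀ t : ℝ, IntegrableOn (fun x ↦ (1 + t • fderiv ℝ h x).det) (ball (0 : E) R) μ := by
    intro t
    refine IntegrableOn.mono_set ?_ ball_subset_closedBall
    refine Continuous.continuousOn ?_ |>.integrableOn_compact (isCompact_closedBall _ _)
    exact ContinuousLinearMap.continuous_det.comp
      (continuous_const.add ((hh.continuous_fderiv one_ne_zero).const_smul t))
  let s := Finset.range (Module.finrank ℝ E + 1)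
  let τ : ℕ → ℝ := fun j ↦ ε / (j + 1)
  have hτ : InjOn τ s := by
    intro i _ j _ hij
    simp only [τ] at hij
    rw [div_eq_div_iff (by positivity) (by positivity)] at hij
    have := mul_left_cancel₀ hε.ne' hij
    exact_mod_cast (add_right_cancel this).symm
  have hτε : ∀ j, 0 ≤ τ j ∧ τ j ≤ ε := fun j ↦
    ⟨by positivity, div_le_self hε.le (by linarith [(Nat.cast_nonneg j : (0 : ℝ) ≤ j)])⟩
  have hlag : ∀ x, (1 + (1 : ℝ) • fderiv ℝ h x).det =
      ∑ j ∈ s, (1 + τ j • fderiv ℝ h x).det * (Lagrange.basis s τ j).eval 1 := by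
    intro x
    obtain ⟨p, hp, hpe⟩ := (fderiv ℝ h x).exists_polynomial_eval_eq_det_one_add_smul
    have hpi := Lagrange.eq_interpolate (f := p) hτ (by simpa [s] using hp)
    rw [← hpe, hpi, Lagrange.interpolate_apply, Polynomial.eval_finsetSum]
    simp [hpe]
  have hzero : ∀ x, (1 + (1 : ℝ) • fderiv ℝ h x).det = 0 := by
    intro x
    have hrx := hd.differentiable one_ne_zero x
    have : (1 + (1 : ℝ) • fderiv ℝ h x) = fderiv ℝ r x := by
      have : fderiv ℝ h x = fderiv ℝ r x - 1 :=
        (hrx.hasFDerivAt.sub (hasFDerivAt_id x)).fderiv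
      rw [this, one_smul, add_sub_cancel]
    rw [this]
    exact det_fderiv_eq_zero_of_norm_eq hR hr hrx
  have hsum : ∑ j ∈ s, (Lagrange.basis s τ j).eval 1 = 1 := by
    rw [← Polynomial.eval_finsetSum, Lagrange.sum_basis hτ ⟨0, by simp [s]⟩, Polynomial.eval_one]
  have hfinal : (0 : ℝ) = μ.real (ball (0 : E) R) :=
    calc (0 : ℝ) = ∫ x in ball (0 : E) R, (1 + (1 : ℝ) • fderiv ℝ h x).det ∂μ := by
          simp only [hzero, integral_zero]
      _ = ∑ j ∈ s, ∫ x in ball (0 : E) R,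
            (1 + τ j • fderiv ℝ h x).det * (Lagrange.basis s τ j).eval 1 ∂μ := by
          simp_rw [hlag]
          exact integral_finsetSum _ fun j _ ↦ (hdet_int (τ j)).mul_const _
      _ = μ.real (ball (0 : E) R) := by
          simp_rw [integral_mul_const, hsmall _ (hτε _).1 (hτε _).2, ← Finset.mul_sum, hsum,
            mul_one]
  exact (ENNReal.toReal_pos (measure_ball_pos μ (0 : E) hR).ne' measure_ball_lt_top.ne).ne hfinal

lemma exists_eq_zero_of_eq_id_off_ball {E : Type*} [NormedAddCommGroup E]
    [InnerProductSpace ℝ E] [FiniteDimensional ℝ E] {v : E → E} (hv : Continuous v) {R : ℝ}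
    (hR : 0 < R) (hid : ∀ x, R ≤ ‖x‖ → v x = x) : ∃ x, v x = 0 := by
  by_contra! hne
  obtain ⟨m, hm, hmv⟩ : ∃ m > 0, ∀ x, m ≤ ‖v x‖ := by
    obtain ⟨x₁, -, hx₁⟩ := (isCompact_closedBall (0 : E) R).exists_isMinOn
      ⟨0, by simp [hR.le]⟩ hv.norm.continuousOn
    refine ⟨min R ‖v x₁‖, lt_min hR (norm_pos_iff.mpr (hne x₁)), fun x ↦ ?_⟩
    rcases le_total R ‖x‖ with hx | hx
    · rw [hid x hx]
      exact (min_le_left _ _).trans hx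
    · exact (min_le_right _ _).trans (hx₁ (by simpa using hx))
  obtain ⟨g, hg, hgv, hgs⟩ := (hv.sub continuous_id).exists_contDiff_approx 1
    (continuous_const (y := m)) (fun _ ↦ hm)
  have hw : ContDiff ℝ 1 (fun x ↦ x + g x) := contDiff_id.add hg
  have hw0 : ∀ x, x + g x ≠ 0 := by
    intro x hx
    have h1 := hgv x
    rw [dist_eq_norm, eq_neg_of_add_eq_zero_right hx, Pi.sub_apply, id, neg_sub_left,
      sub_add_cancel, norm_neg] at h1
    exact absurd h1 (hmv x).not_gt
  refine not_exists_contDiff_retraction_sphere hR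
    (r := fun x ↦ (R * ‖x + g x‖⁻¹) • (x + g x)) ?_ ?_ ?_
  · exact (contDiff_const.mul ((hw.norm ℝ hw0).inv fun x ↦ norm_ne_zero_iff.mpr (hw0 x))).smul hw
  · intro x
    have := norm_ne_zero_iff.mpr (hw0 x)
    rw [norm_smul, norm_mul, norm_inv, norm_norm, Real.norm_of_nonneg hR.le]
    field_simp
  · intro x hx
    have : g x = 0 := by
      by_contra hgx
      exact hgs hgx (by simp [hid x hx.ge])
    simp [this, hx, hR.ne']

/-- A form of **Brouwer's fixed point theorem**. -/
theorem exists_fixedPoint_of_bounded_range {E : Type*} [NormedAddCommGroup E]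
    [InnerProductSpace ℝ E] [FiniteDimensional ℝ E] {T : E → E} (hT : Continuous T) {R : ℝ}
    (hR : ∀ x, ‖T x‖ ≤ R) : ∃ x, T x = x := by
  have hR0 : 0 ≤ R := (norm_nonneg _).trans (hR 0)
  let χ : E → ℝ := fun x ↦ max 0 (min 1 (R + 1 - ‖x‖))
  have hχ : Continuous χ := by fun_prop
  obtain ⟨x, hx⟩ := exists_eq_zero_of_eq_id_off_ball (v := fun x ↦ x - χ x • T x)
    (continuous_id.sub (hχ.smul hT)) (R := R + 1) (by linarith) (fun x hx ↦ by
      have : χ x = 0 := max_eq_left ((min_le_right _ _).trans (by linarith))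
      simp [this])
  have hx' : x = χ x • T x := sub_eq_zero.mp hx
  have hχ0 : 0 ≤ χ x := le_max_left _ _
  have hχ1 : χ x ≤ 1 := max_le zero_le_one (min_le_left _ _)
  have hxR : ‖x‖ ≤ R := by
    rw [hx', norm_smul, Real.norm_of_nonneg hχ0]
    nlinarith [hR x, norm_nonneg (T x)]
  have : χ x = 1 := by
    simp only [χ]
    rw [min_eq_left (by linarith), max_eq_right zero_le_one]
  exact ⟨x, by rw [this, one_smul] at hx'; exact hx'.symm⟩

/-- The **Knaster–Kuratowski–Mazurkiewicz lemma** for a finite family of points. -/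
theorem exists_mem_iInter_of_kkm {ι X : Type*} [Fintype ι] [AddCommGroup X]
    [Module ℝ X] [TopologicalSpace X] [IsTopologicalAddGroup X] [ContinuousSMul ℝ X]
    (p : ι → X) (G : ι → Set X) (hG : ∀ i, IsClosed (G i))
    (hkkm : ∀ w : ι → ℝ, (∀ i, 0 ≤ w i) → ∑ i, w i = 1 → ∃ j, 0 < w j ∧ ∑ i, w i • p i ∈ G j) :
    ∃ x, ∀ i, x ∈ G i := by
  classical
  let E := EuclideanSpace ℝ ι
  let φ : E → X := fun w ↦ ∑ i, w i • p i
  have hcoord : ∀ i, Continuous fun w : E ↦ w i := fun i ↦ PiLp.continuous_apply 2 _ i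
  have hφ : Continuous φ := continuous_finsetSum _ fun i _ ↦ (hcoord i).smul continuous_const
  let K : ι → Set E := fun j ↦ {w | (∀ i, 0 ≤ w i) ∧ ∑ i, w i = 1 ∧ φ w ∈ G j}
  have hK : ∀ j, IsClosed (K j) := fun j ↦ by
    simp only [K, ofPred_and, ofPred_forall]
    refine (isClosed_iInter fun i ↦ isClosed_le continuous_const (hcoord i)).inter
      ((isClosed_eq (continuous_finsetSum _ fun i _ ↦ hcoord i) continuous_const).inter
        ((hG j).preimage hφ))
  have hKne : ∀ j, (K j).Nonempty := fun j ↦ by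
    refine ⟨EuclideanSpace.single j 1, fun i ↦ ?_, by simp, ?_⟩
    · simp only [PiLp.single_apply]
      split_ifs <;> simp
    · obtain ⟨i, hi, hmem⟩ := hkkm (fun i ↦ if i = j then 1 else 0)
        (fun i ↦ by split_ifs <;> simp) (by simp)
      obtain rfl : i = j := by
        by_contra h
        simp [h] at hi
      simpa [φ] using hmem
  by_contra! hcon
  let d : ι → E → ℝ := fun j w ↦ infDist w (K j)
  have hd0 : ∀ j w, 0 ≤ d j w := fun j w ↦ infDist_nonneg
  have hpos : ∀ w, 0 < ∑ j, d j w := by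
    intro w
    refine (Finset.sum_nonneg fun j _ ↦ hd0 j w).lt_of_ne' fun h ↦ ?_
    rw [Finset.sum_eq_zero_iff_of_nonneg fun j _ ↦ hd0 j w] at h
    obtain ⟨i, hi⟩ := hcon (φ w)
    exact hi (((hK i).mem_iff_infDist_zero (hKne i)).mpr (h i (Finset.mem_univ i))).2.2
  have hdc : ∀ j, Continuous (d j) := fun j ↦ continuous_infDist_pt _
  let T : E → E := fun w ↦ WithLp.toLp 2 fun j ↦ d j w / ∑ i, d i w
  have hT : Continuous T := by
    refine (PiLp.continuous_toLp 2 _).comp (continuous_pi fun j ↦ ?_)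
    exact (hdc j).div (continuous_finsetSum _ fun i _ ↦ hdc i) fun w ↦ (hpos w).ne'
  have hT0 : ∀ w j, 0 ≤ T w j := fun w j ↦ div_nonneg (hd0 j w) (hpos w).le
  have hT1 : ∀ w, ∑ j, T w j = 1 := fun w ↦ by
    simp only [T]
    rw [← Finset.sum_div, div_self (hpos w).ne']
  have hTb : ∀ w, ‖T w‖ ≤ 1 := fun w ↦ by
    rw [EuclideanSpace.norm_eq, Real.sqrt_le_one, ← hT1 w]
    refine Finset.sum_le_sum fun j _ ↦ ?_
    have : T w j ≤ 1 := hT1 w ▸ Finset.single_le_sum (fun i _ ↦ hT0 w i) (Finset.mem_univ j)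
    rw [Real.norm_of_nonneg (hT0 w j)]
    nlinarith [hT0 w j]
  obtain ⟨w, hw⟩ := exists_fixedPoint_of_bounded_range hT hTb
  have hw0 : ∀ i, 0 ≤ w i := fun i ↦ by rw [← hw]; exact hT0 w i
  have hw1 : ∑ i, w i = 1 := by
    have := hT1 w
    rwa [hw] at this
  obtain ⟨j, hj, hmem⟩ := hkkm w hw0 hw1
  have hdj : d j w = 0 := infDist_zero_of_mem (show w ∈ K j from ⟨hw0, hw1, hmem⟩)
  have : w j = d j w / ∑ i, d i w := by
    conv_lhs => rw [← hw]
  rw [hdj, zero_div] at this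
  exact hj.ne' this

lemma exists_pos_weight_of_forall_fin {X : Type*} [AddCommGroup X] [Module ℝ X] {C : Set X}
    {G : X → Set X} (hself : ∀ x ∈ C, x ∈ G x)
    (hfin : ∀ n : ℕ, 0 < n → ∀ x : Fin n → X, (∀ i, x i ∈ C) →
      ∀ l : Fin n → ℝ, (∀ i, 0 < l i ∧ l i < 1) → ∑ i, l i = 1 →
      ∃ j, ∑ i, l i • x i ∈ G (x j))
    {ι : Type*} [Fintype ι] {p : ι → X} (hp : ∀ i, p i ∈ C) {w : ι → ℝ} (hw0 : ∀ i, 0 ≤ w i)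
    (hw1 : ∑ i, w i = 1) : ∃ j, 0 < w j ∧ ∑ i, w i • p i ∈ G (p j) := by
  classical
  by_cases hone : ∃ i, w i = 1
  · obtain ⟨i, hi⟩ := hone
    have hz : ∀ j, j ≠ i → w j = 0 := by
      intro j hj
      rw [← Finset.add_sum_erase _ _ (Finset.mem_univ i), hi, add_eq_left,
        Finset.sum_eq_zero_iff_of_nonneg fun j _ ↦ hw0 j] at hw1
      exact hw1 j (by simp [hj])
    refine ⟨i, by simp [hi], ?_⟩
    rw [Finset.sum_eq_single i (fun j _ hj ↦ by simp [hz j hj]) (by simp), hi, one_smul]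
    exact hself _ (hp i)
  · push Not at hone
    have hlt : ∀ i, w i < 1 := fun i ↦
      (hw1 ▸ Finset.single_le_sum (fun i _ ↦ hw0 i) (Finset.mem_univ i)).lt_of_ne (hone i)
    let e := (Fintype.equivFin {i // 0 < w i}).symm
    have he : Function.Injective fun k ↦ (e k : ι) := Subtype.val_injective.comp e.injective
    have hzero : ∀ i ∉ range fun k ↦ (e k : ι), w i = 0 := fun i hi ↦ by
      by_contra h
      exact hi ⟨e.symm ⟨i, (hw0 i).lt_of_ne' h⟩, by simp⟩
    obtain ⟨i₀, hi₀⟩ : ∃ i, 0 < w i := by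
      by_contra! h
      have := Finset.sum_nonpos fun i (_ : i ∈ Finset.univ) ↦ h i
      linarith
    have : Nonempty {i // 0 < w i} := ⟨⟨i₀, hi₀⟩⟩
    obtain ⟨k, hk⟩ := hfin _ Fintype.card_pos (fun k ↦ p (e k)) (fun k ↦ hp _)
      (fun k ↦ w (e k)) (fun k ↦ ⟨(e k).2, hlt _⟩) 
      ((Fintype.sum_of_injective _ he _ w hzero fun _ ↦ rfl).trans hw1)
    rw [Fintype.sum_of_injective _ he _ (fun i ↦ w i • p i)
      (fun i hi ↦ by rw [hzero i hi, zero_smul]) fun _ ↦ rfl] at hk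
    exact ⟨e k, (e k).2, hk⟩

/-- Theorem 2.3: existence of solutions to split variational inequality problems
in Banach spaces, via the Fan-KKM theorem. -/
theorem svip_existence
    {X Y : Type*} [NormedAddCommGroup X] [NormedSpace ℝ X] [CompleteSpace X]
    [NormedAddCommGroup Y] [NormedSpace ℝ Y] [CompleteSpace Y]
    (C : Set X) (D : Set Y)
    (hCne : C.Nonempty) (hCcl : IsClosed C) (hCcv : Convex ℝ C)
    (hDne : D.Nonempty) (hDcl : IsClosed D) (hDcv : Convex ℝ D)
    (f : X → (X →L[ℝ] ℝ)) (g : Y → (Y →L[ℝ] ℝ))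
    (hf : ContinuousOn f C) (hg : ContinuousOn g D)
    (A : X →L[ℝ] Y)
    (ha1 : A '' C = D)
    -- (a2): A is convexity direction reserved with respect to f and g on C and D
    (ha2 : ∀ (n : ℕ), 0 < n → ∀ (x : Fin n → X), (∀ i, x i ∈ C) →
      ∀ (l : Fin n → ℝ), (∀ i, 0 < l i ∧ l i < 1) → (∑ i, l i) = 1 →
      ∃ j, 0 ≤ f (∑ i, l i • x i) (x j - ∑ i, l i • x i) ∧
        0 ≤ g (A (∑ i, l i • x i)) (A (x j) - A (∑ i, l i • x i)))
    (x₀ : X) (hx₀ : x₀ ∈ C)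
    (hcpt : IsCompact {p : X × Y | p.1 ∈ C ∧ p.2 = A p.1 ∧
      0 ≤ f p.1 (x₀ - p.1) ∧ 0 ≤ g (A p.1) (A x₀ - A p.1)}) :
    ∃ xs ∈ C, (∀ x ∈ C, 0 ≤ f xs (x - xs)) ∧ A xs ∈ D ∧
      ∀ y ∈ D, 0 ≤ g (A xs) (y - A xs) := by
  let G : X → Set X := fun x ↦
    {z | z ∈ C ∧ 0 ≤ f z (x - z) ∧ 0 ≤ g (A z) (A x - A z)}
  have hgA : ContinuousOn (fun z ↦ g (A z)) C :=
    hg.comp A.continuous.continuousOn fun z hz ↦ ha1 ▸ mem_image_of_mem A hz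
  have hGcl : ∀ x, IsClosed (G x) := by
    intro x
    have h1 : ContinuousOn (fun z ↦ f z (x - z)) C :=
      hf.clm_apply (continuous_const.sub continuous_id).continuousOn
    have h2 : ContinuousOn (fun z ↦ g (A z) (A x - A z)) C :=
      hgA.clm_apply (continuous_const.sub A.continuous).continuousOn
    exact (h1.prodMk h2).preimage_isClosed_of_isClosed hCcl (isClosed_Ici.prod isClosed_Ici)
  have hG₀ : IsCompact (G x₀) := by
    convert hcpt.image continuous_fst using 1
    ext z
    simp only [G, mem_ofPred_eq, mem_image, Prod.exists, exists_and_right, exists_eq_right]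
    exact ⟨fun h ↦ ⟨A z, h.1, rfl, h.2⟩, fun ⟨_, h1, _, h2⟩ ↦ ⟨h1, h2⟩⟩
  have hfinite : ∀ u : Finset C, (G x₀ ∩ ⋂ x ∈ u, G (x : C)).Nonempty := by
    intro u
    let p : Option u → X := fun o ↦ o.elim x₀ fun x ↦ ((x : C) : X)
    have hp : ∀ i, p i ∈ C := fun i ↦ by
      cases i with
      | none => exact hx₀
      | some x => exact (x : C).2
    obtain ⟨z, hz⟩ := exists_mem_iInter_of_kkm p (fun i ↦ G (p i)) (fun i ↦ hGcl _)
      fun w hw0 hw1 ↦ exists_pos_weight_of_forall_fin (C := C) (G := G)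
        (fun x hx ↦ ⟨hx, by simp, by simp⟩)
        (fun n hn x hx l hl hl1 ↦ by
          obtain ⟨j, hj⟩ := ha2 n hn x hx l hl hl1
          exact ⟨j, hCcv.sum_mem (fun i _ ↦ (hl i).1.le) hl1 (fun i _ ↦ hx i), hj⟩)
        hp hw0 hw1
    exact ⟨z, hz none, mem_iInter₂.mpr fun x hx ↦ hz (some ⟨x, hx⟩)⟩
  obtain ⟨z, hz₀, hz⟩ := hG₀.inter_iInter_nonempty (fun x : C ↦ G x) (fun x ↦ hGcl x) hfinite
  rw [mem_iInter] at hz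
  refine ⟨z, hz₀.1, fun x hx ↦ (hz ⟨x, hx⟩).2.1, ha1 ▸ mem_image_of_mem A hz₀.1, fun y hy ↦ ?_⟩
  rw [← ha1] at hy
  obtain ⟨x, hx, rfl⟩ := hy
  exact (hz ⟨x, hx⟩).2.2
end

section
/- Let (X, ≼) be a partially ordered Banach space and let C be a nonempty compact subset of X. Then (C, ≼) is chain complete: every nonempty chain E ⊆ C has a least upper bound belonging to C, i.e., there exists m ∈ C with e ≼ m for all e ∈ E, and m ≼ b for every b ∈ C that is an upper bound of E. -/
/-- Lemma 3.2(i): a nonempty compact subset of a partially ordered Banach space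
is chain complete. -/
theorem compact_subset_chain_complete
    {X : Type*} [NormedAddCommGroup X] [NormedSpace ℝ X] [CompleteSpace X]
    [PartialOrder X]
    (hnat : ∀ u : X, IsClosed {x : X | x ≤ u} ∧ IsClosed {x : X | u ≤ x})
    (hsmul : ∀ α : ℝ, 0 ≤ α → ∀ u v : X, u ≤ v → α • u ≤ α • v)
    (hadd : ∀ u v w : X, u ≤ v → u + w ≤ v + w)
    (C : Set X) (hCne : C.Nonempty) (hCcpt : IsCompact C)
    (E : Set X) (hEsub : E ⊆ C) (hEne : E.Nonempty) (hEchain : IsChain (· ≤ ·) E) :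
    ∃ m ∈ C, (∀ e ∈ E, e ≤ m) ∧ ∀ b ∈ C, (∀ e ∈ E, e ≤ b) → m ≤ b := by
  have hcl : IsCompact (closure E) := hCcpt.of_isClosed_subset isClosed_closure
    (closure_minimal hEsub hCcpt.isClosed)
  have : Nonempty E := hEne.to_subtype
  obtain ⟨m, hm⟩ := IsCompact.nonempty_iInter_of_directed_nonempty_isCompact_isClosed
    (fun e : E => closure E ∩ {x : X | (e : X) ≤ x})
    (by
      intro a b
      rcases hEchain.total a.2 b.2 with h | h
      · exact ⟨b, fun x hx => ⟨hx.1, h.trans hx.2⟩, fun x hx => hx⟩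
      · exact ⟨a, fun x hx => hx, fun x hx => ⟨hx.1, h.trans hx.2⟩⟩)
    (fun e => ⟨e, subset_closure e.2, le_refl (e : X)⟩)
    (fun e => hcl.inter_right (hnat e).2)
    (fun e => isClosed_closure.inter (hnat e).2)
  rw [Set.mem_iInter] at hm
  have hmE : m ∈ closure E := (hm (Classical.arbitrary E)).1
  exact ⟨m, closure_minimal hEsub hCcpt.isClosed hmE, fun e he => (hm ⟨e, he⟩).2,
    fun b _ hb => closure_minimal (t := {x : X | x ≤ b}) hb (hnat b).1 hmE⟩
end

section
/- Let (X, ≼) be a partially ordered Banach space and let C be a nonempty, bounded, closed and convex subset of X that is compact in the weak topology of X. Then (C, ≼) is chain complete: every nonempty chain E ⊆ C has a least upper bound belonging to C, i.e., there exists m ∈ C with e ≼ m for all e ∈ E, and m ≼ b for every b ∈ C that is an upper bound of E. -/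
/-- A closed convex subset of a weakly compact set is weakly compact and weakly closed. -/
theorem isCompact_isClosed_toWeakSpace_image_of_subset
    {X : Type*} [NormedAddCommGroup X] [NormedSpace ℝ X] {C T : Set X}
    (hC : IsCompact (toWeakSpace ℝ X '' C)) (hTC : T ⊆ C) (hT : IsClosed T)
    (hTconv : Convex ℝ T) :
    IsCompact (toWeakSpace ℝ X '' T) ∧ IsClosed (toWeakSpace ℝ X '' T) := by
  have hclosed : IsClosed (toWeakSpace ℝ X '' T) := by
    rw [← hT.closure_eq, hTconv.toWeakSpace_closure ℝ]
    exact isClosed_closure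
  exact ⟨hC.of_isClosed_subset hclosed (Set.image_mono hTC), hclosed⟩

/-- Lemma 3.2(ii): a nonempty, bounded, closed and convex subset of a partially
ordered Banach space which is weakly compact is chain complete. -/
theorem weakly_compact_convex_subset_chain_complete
    {X : Type*} [NormedAddCommGroup X] [NormedSpace ℝ X] [CompleteSpace X]
    [PartialOrder X]
    (hnat : ∀ u : X, IsClosed {x : X | x ≤ u} ∧ IsClosed {x : X | u ≤ x})
    (hsmul : ∀ α : ℝ, 0 ≤ α → ∀ u v : X, u ≤ v → α • u ≤ α • v)
    (hadd : ∀ u v w : X, u ≤ v → u + w ≤ v + w)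
    (C : Set X) (hCne : C.Nonempty) (hCbdd : Bornology.IsBounded C)
    (hCcl : IsClosed C) (hCcv : Convex ℝ C)
    (hCwcpt : IsCompact (toWeakSpace ℝ X '' C))
    (E : Set X) (hEsub : E ⊆ C) (hEne : E.Nonempty) (hEchain : IsChain (· ≤ ·) E) :
    ∃ m ∈ C, (∀ e ∈ E, e ≤ m) ∧ ∀ b ∈ C, (∀ e ∈ E, e ≤ b) → m ≤ b := by
  have : IsOrderedAddMonoid X :=
    { add_le_add_left := fun u v h w => hadd u v w h
      add_le_add_right := fun u v h w => by simpa only [add_comm] using hadd u v w h }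
  have : PosSMulMono ℝ X := ⟨fun α hα u v h => hsmul α hα u v h⟩
  let B : Set X := {b | b ∈ C ∧ ∀ e ∈ E, e ≤ b}
  let T : E → Set X := fun e => C ∩ (Set.Ici e.1 ∩ ⋂ b ∈ B, Set.Iic b)
  have hTclosed (e : E) : IsClosed (T e) :=
    hCcl.inter ((hnat e).2.inter (isClosed_biInter fun b _ => (hnat b).1))
  have hTconv (e : E) : Convex ℝ (T e) :=
    hCcv.inter ((convex_Ici _).inter (convex_iInter₂ fun b _ => convex_Iic b))
  have hTcompact (e : E) := isCompact_isClosed_toWeakSpace_image_of_subset hCwcpt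
    Set.inter_subset_left (hTclosed e) (hTconv e)
  have hTne (e : E) : (T e).Nonempty :=
    ⟨e, hEsub e.2, le_rfl, Set.mem_iInter₂.2 fun b hb => hb.2 e e.2⟩
  have hTanti {e f : E} (hef : e.1 ≤ f.1) : T f ⊆ T e :=
    fun x hx => ⟨hx.1, hef.trans hx.2.1, hx.2.2⟩
  have hTdir : Directed (· ⊇ ·) fun e => toWeakSpace ℝ X '' T e := by
    intro e f
    rcases hEchain.total e.2 f.2 with h | h
    · exact ⟨f, Set.image_mono (hTanti h), subset_rfl⟩
    · exact ⟨e, subset_rfl, Set.image_mono (hTanti h)⟩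
  have : Nonempty E := hEne.to_subtype
  obtain ⟨y, hy⟩ := IsCompact.nonempty_iInter_of_directed_nonempty_isCompact_isClosed
    _ hTdir (fun e => (hTne e).image _) (fun e => (hTcompact e).1) (fun e => (hTcompact e).2)
  obtain ⟨m, rfl⟩ := (toWeakSpace ℝ X).surjective y
  have hm (e : E) : m ∈ T e :=
    (toWeakSpace ℝ X).injective.mem_set_image.1 (Set.mem_iInter.1 hy e)
  obtain ⟨e₀, he₀⟩ := hEne
  exact ⟨m, (hm ⟨e₀, he₀⟩).1, fun e he => (hm ⟨e, he⟩).2.1,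
    fun b hb hub => Set.mem_iInter₂.1 (hm ⟨e₀, he₀⟩).2.2 b ⟨hb, hub⟩⟩
end

section
/- Let X and Y be real Banach spaces, C ⊆ X and D ⊆ Y nonempty, closed and convex subsets, and let (U, ≼) be a partially ordered real vector space. Let φ : C → U and ψ : D → U be ≼-continuous operators and A : X → Y a bounded linear operator such that (a1) A(C) = D and (a2) A is convexity order reserved with respect to φ and ψ on C and D. Suppose there is a point x₀ ∈ C such that the set {(x', Ax') ∈ C × D : φ(x') ≼ φ(x₀) and ψ(Ax') ≼ ψ(Ax₀)} is compact in X × Y. Then there exists x* ∈ C such that φ(x*) ≼ φ(x) for all x ∈ C and, with y* = Ax* ∈ D, ψ(y*) ≼ ψ(y) for all y ∈ D. -/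
/-- Two closed sets that contain an endpoint each and together cover the open segment meet. -/
theorem inter_nonempty_of_openSegment_subset_union {E : Type*} [AddCommGroup E] [Module ℝ E]
    [TopologicalSpace E] [ContinuousAdd E] [ContinuousSMul ℝ E] {a b : E} {s t : Set E}
    (hs : IsClosed s) (ht : IsClosed t) (ha : a ∈ s) (hb : b ∈ t)
    (hst : openSegment ℝ a b ⊆ s ∪ t) : (s ∩ t).Nonempty := by
  have hcover : segment ℝ a b ⊆ s ∪ t := by
    rw [← insert_endpoints_openSegment]
    exact Set.insert_subset (Or.inl ha) (Set.insert_subset (Or.inr hb) hst)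
  exact (isPreconnected_closed_iff.1 (convex_segment a b).isPreconnected s t hs ht hcover
    ⟨a, left_mem_segment ℝ a b, ha⟩ ⟨b, right_mem_segment ℝ a b, hb⟩).mono
    Set.inter_subset_right

/-- A downward directed transitive relation with closed lower sets, one of which is compact,
has a least element. -/
theorem exists_least_of_directed_of_isCompact {E : Type*} [TopologicalSpace E]
    {C : Set E} {r : E → E → Prop}
    (htrans : ∀ x y z, r x y → r y z → r x z)
    (hclosed : ∀ x ∈ C, IsClosed {z | z ∈ C ∧ r z x})
    (hdir : ∀ a ∈ C, ∀ b ∈ C, ∃ z ∈ C, r z a ∧ r z b)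
    {x₀ : E} (hx₀ : x₀ ∈ C) (hcpt : IsCompact {z | z ∈ C ∧ r z x₀}) :
    ∃ z ∈ C, ∀ x ∈ C, r z x := by
  have : Nonempty C := ⟨⟨x₀, hx₀⟩⟩
  obtain ⟨z, hz⟩ := IsCompact.nonempty_iInter_of_directed_nonempty_isCompact_isClosed
    (fun x : C => {z | z ∈ C ∧ r z x₀} ∩ {z | z ∈ C ∧ r z x})
    (by
      rintro ⟨a, ha⟩ ⟨b, hb⟩
      obtain ⟨c, hc, hca, hcb⟩ := hdir a ha b hb
      exact ⟨⟨c, hc⟩, fun z hz => ⟨hz.1, hz.2.1, htrans z c a hz.2.2 hca⟩,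
        fun z hz => ⟨hz.1, hz.2.1, htrans z c b hz.2.2 hcb⟩⟩)
    (by
      rintro ⟨x, hx⟩
      obtain ⟨z, hz, hz₀, hzx⟩ := hdir x₀ hx₀ x hx
      exact ⟨z, ⟨hz, hz₀⟩, hz, hzx⟩)
    (fun x => hcpt.inter_right (hclosed x x.2))
    (fun x => (hclosed x₀ hx₀).inter (hclosed x x.2))
  rw [Set.mem_iInter] at hz
  exact ⟨z, (hz ⟨x₀, hx₀⟩).1.1, fun x hx => (hz ⟨x, hx⟩).2.2⟩


/-- Theorem 4.1: existence of solutions to the ordered split convex minimization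
problem, with values in a partially ordered real vector space (U, ≼). -/
theorem ordered_split_minimization_existence
    {X Y U : Type*} [NormedAddCommGroup X] [NormedSpace ℝ X] [CompleteSpace X]
    [NormedAddCommGroup Y] [NormedSpace ℝ Y] [CompleteSpace Y]
    [AddCommGroup U] [Module ℝ U] [PartialOrder U]
    -- (U, ≼) is a partially ordered real vector space
    (hUsmul : ∀ α : ℝ, 0 ≤ α → ∀ u v : U, u ≤ v → α • u ≤ α • v)
    (hUadd : ∀ u v w : U, u ≤ v → u + w ≤ v + w)
    (C : Set X) (D : Set Y)
    (hCne : C.Nonempty) (hCcl : IsClosed C) (hCcv : Convex ℝ C)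
    (hDne : D.Nonempty) (hDcl : IsClosed D) (hDcv : Convex ℝ D)
    (φ : X → U) (ψ : Y → U)
    -- φ and ψ are ≼-continuous
    (hφ : ∀ u : U, IsClosed {x | x ∈ C ∧ φ x ≤ u} ∧ IsClosed {x | x ∈ C ∧ u ≤ φ x})
    (hψ : ∀ u : U, IsClosed {y | y ∈ D ∧ ψ y ≤ u} ∧ IsClosed {y | y ∈ D ∧ u ≤ ψ y})
    (A : X →L[ℝ] Y)
    -- (a1): A(C) = D
    (ha1 : A '' C = D)
    -- (a2): A is convexity order reserved with respect to φ and ψ on C and D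
    (ha2 : ∀ (n : ℕ), 0 < n → ∀ (x : Fin n → X), (∀ i, x i ∈ C) →
      ∀ (l : Fin n → ℝ), (∀ i, 0 < l i ∧ l i < 1) → (∑ i, l i) = 1 →
      ∃ j, φ (∑ i, l i • x i) ≤ φ (x j) ∧ ψ (A (∑ i, l i • x i)) ≤ ψ (A (x j)))
    (x₀ : X) (hx₀ : x₀ ∈ C)
    (hcpt : IsCompact {p : X × Y | p.1 ∈ C ∧ p.2 = A p.1 ∧
      φ p.1 ≤ φ x₀ ∧ ψ (A p.1) ≤ ψ (A x₀)}) :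
    ∃ xs ∈ C, (∀ x ∈ C, φ xs ≤ φ x) ∧ A xs ∈ D ∧ ∀ y ∈ D, ψ (A xs) ≤ ψ y := by
  have hAmem : ∀ x ∈ C, A x ∈ D := fun x hx => ha1 ▸ Set.mem_image_of_mem A hx
  let r : X → X → Prop := fun z x => φ z ≤ φ x ∧ ψ (A z) ≤ ψ (A x)
  have hclosed : ∀ x ∈ C, IsClosed {z | z ∈ C ∧ r z x} := by
    intro x _
    convert (hφ (φ x)).1.inter ((hψ (ψ (A x))).1.preimage A.continuous) using 1
    ext z
    exact ⟨fun h => ⟨⟨h.1, h.2.1⟩, hAmem z h.1, h.2.2⟩, fun h => ⟨h.1.1, h.1.2, h.2.2⟩⟩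
  have hdir : ∀ a ∈ C, ∀ b ∈ C, ∃ z ∈ C, r z a ∧ r z b := by
    intro a ha b hb
    obtain ⟨z, hza, hzb⟩ := inter_nonempty_of_openSegment_subset_union
      (hclosed a ha) (hclosed b hb) ⟨ha, le_rfl, le_rfl⟩ ⟨hb, le_rfl, le_rfl⟩ (by
        intro z hz
        have hzC : z ∈ C := hCcv.openSegment_subset ha hb hz
        obtain ⟨s, t, hs, ht, hst, rfl⟩ := hz
        obtain ⟨j, hj⟩ := ha2 2 two_pos ![a, b] (by simp [Fin.forall_fin_two, ha, hb])
          ![s, t] (by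
            rw [Fin.forall_fin_two]
            exact ⟨⟨hs, by simp; linarith⟩, ⟨ht, by simp; linarith⟩⟩)
          (by simpa using hst)
        rw [Fin.sum_univ_two] at hj
        fin_cases j
        · exact Or.inl ⟨hzC, hj⟩
        · exact Or.inr ⟨hzC, hj⟩)
    exact ⟨z, hza.1, hza.2, hzb.2⟩
  have hcpt' : IsCompact {z | z ∈ C ∧ r z x₀} := by
    convert hcpt.image continuous_fst using 1
    ext z
    constructor
    · exact fun h => ⟨(z, A z), ⟨h.1, rfl, h.2⟩, rfl⟩
    · rintro ⟨p, hp, rfl⟩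
      exact ⟨hp.1, hp.2.2⟩
  obtain ⟨z, hz, hle⟩ := exists_least_of_directed_of_isCompact (r := r)
    (fun _ _ _ h h' => ⟨h.1.trans h'.1, h.2.trans h'.2⟩)
    hclosed hdir hx₀ hcpt'
  refine ⟨z, hz, fun x hx => (hle x hx).1, hAmem z hz, ?_⟩
  rw [← ha1]
  rintro _ ⟨x, hx, rfl⟩
  exact (hle x hx).2
end

section
/- Let X and Y be real Banach spaces and C ⊆ X and D ⊆ Y nonempty, closed and convex subsets. Let φ : C → ℝ and ψ : D → ℝ be continuous functions and A : X → Y a bounded linear operator such that (a1) A(C) = D and (a2) A is convexity value reserved with respect to φ and ψ on C and D. Suppose there is a point x₀ ∈ C such that the set {(x', Ax') ∈ C × D : φ(x') ≤ φ(x₀) and ψ(Ax') ≤ ψ(Ax₀)} is compact in X × Y. Then there exists x* ∈ C such that φ(x*) ≤ φ(x) for all x ∈ C and, with y* = Ax* ∈ D, ψ(y*) ≤ ψ(y) for all y ∈ D. -/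
/-- If every point of a segment in `C` is dominated by one of the two endpoints, for `f` and `g`
simultaneously, then any two points of `C` have a common lower bound in `C`. -/
theorem exists_le_le_of_segment_dominated {E : Type*} [NormedAddCommGroup E] [NormedSpace ℝ E]
    {C : Set E} (hC : Convex ℝ C) {f g : E → ℝ} (hf : ContinuousOn f C) (hg : ContinuousOn g C)
    (h : ∀ x ∈ C, ∀ y ∈ C, ∀ z ∈ openSegment ℝ x y,
      (f z ≤ f x ∧ g z ≤ g x) ∨ (f z ≤ f y ∧ g z ≤ g y))
    {x y : E} (hx : x ∈ C) (hy : y ∈ C) :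
    ∃ z ∈ C, (f z ≤ f x ∧ g z ≤ g x) ∧ (f z ≤ f y ∧ g z ≤ g y) := by
  have hsub : segment ℝ x y ⊆ C := hC.segment_subset hx hy
  have hcl : IsClosed (segment ℝ x y) := by
    rw [segment_eq_image_lineMap]
    exact (isCompact_Icc.image AffineMap.lineMap_continuous).isClosed
  have hclosed : ∀ a b : ℝ, IsClosed (segment ℝ x y ∩ (fun z => (f z, g z)) ⁻¹' Set.Iic (a, b)) :=
    fun a b => ((hf.mono hsub).prodMk (hg.mono hsub)).preimage_isClosed_of_isClosed hcl isClosed_Iic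
  have hconn : IsPreconnected (segment ℝ x y) := (convex_segment x y).isPreconnected
  obtain ⟨z, hz, ⟨-, hzx⟩, ⟨-, hzy⟩⟩ := isPreconnected_closed_iff.1 hconn _ _
    (hclosed (f x) (g x)) (hclosed (f y) (g y))
    (fun z hz => by
      rcases eq_or_ne z x with rfl | hzx
      · exact Or.inl ⟨hz, le_rfl, le_rfl⟩
      rcases eq_or_ne z y with rfl | hzy
      · exact Or.inr ⟨hz, le_rfl, le_rfl⟩
      exact (h x hx y hy z (mem_openSegment_of_ne_left_right hzx.symm hzy.symm hz)).imp
        (fun hd => ⟨hz, hd⟩) (fun hd => ⟨hz, hd⟩))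
    ⟨x, left_mem_segment ℝ x y, left_mem_segment ℝ x y, le_rfl, le_rfl⟩
    ⟨y, right_mem_segment ℝ x y, right_mem_segment ℝ x y, le_rfl, le_rfl⟩
  exact ⟨z, hsub hz, hzx, hzy⟩

/-- Two continuous functions whose values are jointly downward directed on `C` have a common
minimizer on `C`, provided some joint sublevel set is compact. -/
theorem exists_common_minimizer_of_directed {E : Type*} [TopologicalSpace E]
    {C : Set E} {f g : E → ℝ} (hf : ContinuousOn f C) (hg : ContinuousOn g C)
    (hdir : ∀ x ∈ C, ∀ y ∈ C, ∃ z ∈ C, (f z ≤ f x ∧ g z ≤ g x) ∧ (f z ≤ f y ∧ g z ≤ g y))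
    {x₀ : E} (hx₀ : x₀ ∈ C) (hK : IsCompact {x | x ∈ C ∧ f x ≤ f x₀ ∧ g x ≤ g x₀}) :
    ∃ m ∈ C, ∀ x ∈ C, f m ≤ f x ∧ g m ≤ g x := by
  have hsub : {x | x ∈ C ∧ f x ≤ f x₀ ∧ g x ≤ g x₀} ⊆ C := fun _ hx => hx.1
  have hne : {x | x ∈ C ∧ f x ≤ f x₀ ∧ g x ≤ g x₀}.Nonempty := ⟨x₀, hx₀, le_rfl, le_rfl⟩
  obtain ⟨a, ha, hamin⟩ := hK.exists_isMinOn hne (hf.mono hsub)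
  obtain ⟨b, hb, hbmin⟩ := hK.exists_isMinOn hne (hg.mono hsub)
  obtain ⟨m, hm, ⟨hma, -⟩, ⟨-, hmb⟩⟩ := hdir a ha.1 b hb.1
  refine ⟨m, hm, fun x hx => ?_⟩
  obtain ⟨z, hz, ⟨hzfx, hzgx⟩, hz₀⟩ := hdir x hx x₀ hx₀
  exact ⟨hma.trans ((hamin ⟨hz, hz₀⟩).trans hzfx), hmb.trans ((hbmin ⟨hz, hz₀⟩).trans hzgx)⟩

/-- Corollary 4.2: existence of solutions to the (real-valued) split convex
minimization problem. -/
theorem split_minimization_existence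
    {X Y : Type*} [NormedAddCommGroup X] [NormedSpace ℝ X] [CompleteSpace X]
    [NormedAddCommGroup Y] [NormedSpace ℝ Y] [CompleteSpace Y]
    (C : Set X) (D : Set Y)
    (hCne : C.Nonempty) (hCcl : IsClosed C) (hCcv : Convex ℝ C)
    (hDne : D.Nonempty) (hDcl : IsClosed D) (hDcv : Convex ℝ D)
    (φ : X → ℝ) (ψ : Y → ℝ)
    (hφ : ContinuousOn φ C) (hψ : ContinuousOn ψ D)
    (A : X →L[ℝ] Y)
    -- (a1): A(C) = D
    (ha1 : A '' C = D)
    -- (a2): A is convexity value reserved with respect to φ and ψ on C and D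
    (ha2 : ∀ (n : ℕ), 0 < n → ∀ (x : Fin n → X), (∀ i, x i ∈ C) →
      ∀ (l : Fin n → ℝ), (∀ i, 0 < l i ∧ l i < 1) → (∑ i, l i) = 1 →
      ∃ j, φ (∑ i, l i • x i) ≤ φ (x j) ∧ ψ (A (∑ i, l i • x i)) ≤ ψ (A (x j)))
    (x₀ : X) (hx₀ : x₀ ∈ C)
    (hcpt : IsCompact {p : X × Y | p.1 ∈ C ∧ p.2 = A p.1 ∧
      φ p.1 ≤ φ x₀ ∧ ψ (A p.1) ≤ ψ (A x₀)}) :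
    ∃ xs ∈ C, (∀ x ∈ C, φ xs ≤ φ x) ∧ A xs ∈ D ∧ ∀ y ∈ D, ψ (A xs) ≤ ψ y := by
  have hmaps : Set.MapsTo A C D := fun x hx => ha1 ▸ Set.mem_image_of_mem A hx
  have hψA : ContinuousOn (fun x => ψ (A x)) C := hψ.comp A.continuous.continuousOn hmaps
  have hK : IsCompact {x | x ∈ C ∧ φ x ≤ φ x₀ ∧ ψ (A x) ≤ ψ (A x₀)} := by
    convert hcpt.image continuous_fst using 1
    ext x
    constructor
    · exact fun hx => ⟨(x, A x), ⟨hx.1, rfl, hx.2⟩, rfl⟩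
    · rintro ⟨p, ⟨hp, -, hp'⟩, rfl⟩
      exact ⟨hp, hp'⟩
  have hdom : ∀ x ∈ C, ∀ y ∈ C, ∀ z ∈ openSegment ℝ x y,
      (φ z ≤ φ x ∧ ψ (A z) ≤ ψ (A x)) ∨ (φ z ≤ φ y ∧ ψ (A z) ≤ ψ (A y)) := by
    rintro x hx y hy z ⟨a, b, ha, hb, hab, rfl⟩
    have hval := ha2 2 two_pos ![x, y] (Fin.forall_fin_two.2 ⟨hx, hy⟩) ![a, b]
      (Fin.forall_fin_two.2 ⟨⟨ha, by simp; linarith⟩, ⟨hb, by simp; linarith⟩⟩)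
      (by simpa using hab)
    simpa only [Fin.sum_univ_two, Fin.exists_fin_two, Matrix.cons_val_zero,
      Matrix.cons_val_one] using hval
  obtain ⟨m, hm, hmin⟩ := exists_common_minimizer_of_directed hφ hψA
    (fun x hx y hy => exists_le_le_of_segment_dominated hCcv hφ hψA hdom hx hy) hx₀ hK
  refine ⟨m, hm, fun x hx => (hmin x hx).1, hmaps hm, fun y hy => ?_⟩
  obtain ⟨x, hx, rfl⟩ := ha1.symm ▸ hy
  exact (hmin x hx).2
end
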